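/- arXiv:2409.19198 — 4 statements merged into one kernel-verified Lean document; each statement's English description precedes it below -/
import Mathlib

section
/- Let M be a strongly atomic Puiseux monoid, let r be a positive rational with r ∉ M, and set S := M + ℕ₀r. If x, y ∈ S and r does not divide x in S, then the pair {x, y} has a maximal common divisor in S. -/
namespace PuiseuxSum

/-- `a` is an atom of the Puiseux monoid `M`: it is a nonzero element of `M`
that cannot be written as a sum of two nonzero elements of `M`. -/
def IsAtom (M : AddSubmonoid ℚ) (a : ℚ) : Prop :=
  a ∈ M ∧ a ≠ 0 ∧ ∀ b ∈ M, ∀ c ∈ M, a = b + c → b = 0 ∨ c = 0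

/-- The Puiseux monoid `M` is atomic if every element of `M` belongs to the
additive submonoid generated by the atoms of `M`. -/
def Atomic (M : AddSubmonoid ℚ) : Prop :=
  ∀ x ∈ M, x ∈ AddSubmonoid.closure {a : ℚ | IsAtom M a}
/-- `c` divides `b` in `M` if `b = c + d` for some `d ∈ M`. -/
def DividesIn (M : AddSubmonoid ℚ) (c b : ℚ) : Prop :=
  ∃ d ∈ M, b = c + d

/-- `d` is a maximal common divisor of `x` and `y` in `M`: it is a common
divisor of `x` and `y` in `M` such that the only common divisor of `x - d` and
`y - d` in `M` is `0`. -/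
def IsMCD (M : AddSubmonoid ℚ) (x y d : ℚ) : Prop :=
  d ∈ M ∧ DividesIn M d x ∧ DividesIn M d y ∧
    ∀ e ∈ M, DividesIn M e (x - d) → DividesIn M e (y - d) → e = 0

/-- `M` is strongly atomic if it is atomic and every pair of elements of `M`
has a maximal common divisor in `M`. -/
def StronglyAtomic (M : AddSubmonoid ℚ) : Prop :=
  Atomic M ∧ ∀ x ∈ M, ∀ y ∈ M, ∃ d, IsMCD M x y d
theorem mem_sup_closure_singleton {M : AddSubmonoid ℚ} {r z : ℚ} :
    z ∈ M ⊔ AddSubmonoid.closure {r} ↔ ∃ k : ℕ, z - k * r ∈ M := by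
  simp only [AddSubmonoid.mem_sup, AddSubmonoid.mem_closure_singleton]
  constructor
  · rintro ⟨m, hm, _, ⟨k, rfl⟩, rfl⟩
    exact ⟨k, by simpa using hm⟩
  · rintro ⟨k, hk⟩
    exact ⟨_, hk, _, ⟨k, rfl⟩, by simp⟩

/-- An element of `M + ℕ₀r` that is not divisible by `r` lies in `M`. -/
theorem mem_of_not_dividesIn {M : AddSubmonoid ℚ} {r z : ℚ}
    (hz : z ∈ M ⊔ AddSubmonoid.closure {r})
    (hndvd : ¬ DividesIn (M ⊔ AddSubmonoid.closure {r}) r z) : z ∈ M := by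
  obtain ⟨k, hk⟩ := mem_sup_closure_singleton.1 hz
  cases k with
  | zero => simpa using hk
  | succ k =>
    refine absurd ⟨z - r, mem_sup_closure_singleton.2 ⟨k, ?_⟩, by ring⟩ hndvd
    convert hk using 1
    push_cast
    ring

theorem DividesIn.add_right {M : AddSubmonoid ℚ} {c a b : ℚ} (h : DividesIn M c a)
    (hb : b ∈ M) : DividesIn M c (a + b) := by
  obtain ⟨d, hd, rfl⟩ := h
  exact ⟨d + b, M.add_mem hd hb, by ring⟩

/-- If `c` is a common divisor of `x` and `y`, then a maximal common divisor of `x - c` and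
`y - c` translates to one of `x` and `y`. -/
theorem IsMCD.add_left {M : AddSubmonoid ℚ} {x y c d : ℚ} (hc : c ∈ M)
    (h : IsMCD M (x - c) (y - c) d) : IsMCD M x y (c + d) := by
  obtain ⟨hd, ⟨u, hu, hxu⟩, ⟨v, hv, hyv⟩, hmax⟩ := h
  refine ⟨M.add_mem hc hd, ⟨u, hu, by linarith⟩, ⟨v, hv, by linarith⟩, fun e he hex hey => ?_⟩
  rw [← sub_sub] at hex hey
  exact hmax e he hex hey

/-- The set `T` bounds the exponents `k` for which `y - k * r` lies in `M`; passing to a proper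
common divisor beyond a maximal common divisor in `M` of `x` and `y - k * r` removes `k`. -/
theorem exists_mcd_of_not_dvd_of_finset {M : AddSubmonoid ℚ} {r : ℚ}
    (hmcd : ∀ x ∈ M, ∀ y ∈ M, ∃ d, IsMCD M x y d) (T : Finset ℕ) (x y : ℚ)
    (hT : ∀ k : ℕ, y - k * r ∈ M → k ∈ T)
    (hx : x ∈ M ⊔ AddSubmonoid.closure {r})
    (hy : y ∈ M ⊔ AddSubmonoid.closure {r})
    (hndvd : ¬ DividesIn (M ⊔ AddSubmonoid.closure {r}) r x) :
    ∃ d, IsMCD (M ⊔ AddSubmonoid.closure {r}) x y d := by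
  induction T using Finset.strongInduction generalizing x y with
  | H T ih =>
    have hle : M ≤ M ⊔ AddSubmonoid.closure {r} := le_sup_left
    obtain ⟨k, hk⟩ := mem_sup_closure_singleton.1 hy
    obtain ⟨d, hd, ⟨u, hu, hxu⟩, ⟨v, hv, hyv⟩, hmax⟩ :=
      hmcd x (mem_of_not_dividesIn hx hndvd) _ hk
    by_cases hS : ∀ e ∈ M ⊔ AddSubmonoid.closure {r},
        DividesIn (M ⊔ AddSubmonoid.closure {r}) e (x - d) →
        DividesIn (M ⊔ AddSubmonoid.closure {r}) e (y - d) → e = 0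
    · exact ⟨d, hle hd, ⟨u, hle hu, hxu⟩,
        ⟨y - d, mem_sup_closure_singleton.2 ⟨k, by convert hv using 1; linarith⟩, by ring⟩, hS⟩
    push Not at hS
    obtain ⟨e, he, ⟨s, hs, hxs⟩, ⟨t, ht, hyt⟩, he0⟩ := hS
    have heM : e ∈ M := mem_of_not_dividesIn he fun h => hndvd <| by
      convert h.add_right (add_mem hs (hle hd)) using 1
      linarith
    have hndvd_s : ¬ DividesIn (M ⊔ AddSubmonoid.closure {r}) r s := fun h => hndvd <| by
      convert h.add_right (add_mem he (hle hd)) using 1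
      linarith
    have hsM : s ∈ M := mem_of_not_dividesIn hs hndvd_s
    have hxs' : x - (d + e) = s := by linarith
    have hyt' : y - (d + e) = t := by linarith
    obtain ⟨d', hd'⟩ := ih (T.erase k) (Finset.erase_ssubset (hT k hk)) s t
      (fun j hj => by
        refine Finset.mem_erase.2 ⟨?_, hT j ?_⟩
        · rintro rfl
          exact he0 (hmax e heM ⟨s, hsM, hxs⟩ ⟨_, hj, by linarith⟩)
        · convert M.add_mem hj (M.add_mem hd heM) using 1
          linarith)
      hs ht hndvd_s
    exact ⟨d + e + d', IsMCD.add_left (add_mem (hle hd) he) (by rwa [hxs', hyt'])⟩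

/-- Let `M` be a strongly atomic Puiseux monoid, `r` a positive rational with
`r ∉ M`, and `S := M + ℕ₀r`.  If `x, y ∈ S` and `r` does not divide `x` in
`S`, then `x` and `y` have a maximal common divisor in `S`. -/
theorem exists_mcd_of_not_dvd (M : AddSubmonoid ℚ)
    (hM : ∀ x ∈ M, (0 : ℚ) ≤ x)
    (r : ℚ) (hr : 0 < r) (hrM : r ∉ M)
    (hsa : StronglyAtomic M)
    (x y : ℚ)
    (hx : x ∈ M ⊔ AddSubmonoid.closure {r})
    (hy : y ∈ M ⊔ AddSubmonoid.closure {r})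
    (hndvd : ¬ DividesIn (M ⊔ AddSubmonoid.closure {r}) r x) :
    ∃ d, IsMCD (M ⊔ AddSubmonoid.closure {r}) x y d := by
  obtain ⟨n, hn⟩ := exists_nat_gt (y / r)
  refine exists_mcd_of_not_dvd_of_finset hsa.2 (Finset.range n) x y (fun k hk => ?_) hx hy hndvd
  have hkr : (k : ℚ) ≤ y / r := (le_div_iff₀ hr).2 (sub_nonneg.1 (hM _ hk))
  exact Finset.mem_range.2 (by exact_mod_cast hkr.trans_lt hn)

end PuiseuxSum
end

section
/- Let M and N be Puiseux monoids such that N is finitely generated. If M is a length-finite factorization monoid (LFFM), then the internal sum M + N is an LFFM. -/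
namespace PuiseuxSum

/-- A factorization of `q` in `M` is a multiset of atoms of `M` whose sum
is `q`. -/
def IsFactorization (M : AddSubmonoid ℚ) (q : ℚ) (s : Multiset ℚ) : Prop :=
  (∀ a ∈ s, IsAtom M a) ∧ s.sum = q

/-- `M` is a finite factorization monoid (FFM) if it is atomic and every
element of `M` has only finitely many factorizations. -/
def FFM (M : AddSubmonoid ℚ) : Prop :=
  Atomic M ∧ ∀ q ∈ M, {s : Multiset ℚ | IsFactorization M q s}.Finite

/-- `M` is a bounded factorization monoid (BFM) if it is atomic and for every
`q ∈ M` the set of lengths of factorizations of `q` is finite. -/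
def BFM (M : AddSubmonoid ℚ) : Prop :=
  Atomic M ∧
    ∀ q ∈ M, {ℓ : ℕ | ∃ s : Multiset ℚ, IsFactorization M q s ∧ Multiset.card s = ℓ}.Finite

/-- `M` is a length-finite factorization monoid (LFFM) if it is atomic and for
every `q ∈ M` and every length `ℓ` there are only finitely many
factorizations of `q` of length `ℓ`. -/
def LFFM (M : AddSubmonoid ℚ) : Prop :=
  Atomic M ∧
    ∀ q ∈ M, ∀ ℓ : ℕ,
      {s : Multiset ℚ | IsFactorization M q s ∧ Multiset.card s = ℓ}.Finite

theorem mem_sup_closure_singleton_s7 {M : AddSubmonoid ℚ} {b x : ℚ} :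
    x ∈ M ⊔ AddSubmonoid.closure {b} ↔ ∃ m ∈ M, ∃ n : ℕ, m + n * b = x := by
  simp [AddSubmonoid.mem_sup, AddSubmonoid.mem_closure_singleton]

theorem nonneg_of_mem_sup {M N : AddSubmonoid ℚ} (hM : ∀ x ∈ M, (0 : ℚ) ≤ x)
    (hN : ∀ x ∈ N, (0 : ℚ) ≤ x) : ∀ x ∈ M ⊔ N, (0 : ℚ) ≤ x := by
  intro x hx
  obtain ⟨m, hm, n, hn, rfl⟩ := AddSubmonoid.mem_sup.1 hx
  exact add_nonneg (hM m hm) (hN n hn)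

theorem IsAtom.of_le {M N : AddSubmonoid ℚ} (hle : M ≤ N) {a : ℚ} (ha : IsAtom N a)
    (haM : a ∈ M) : IsAtom M a :=
  ⟨haM, ha.2.1, fun c hc d hd h => ha.2.2 c (hle hc) d (hle hd) h⟩

theorem IsFactorization.mem {M : AddSubmonoid ℚ} {q : ℚ} {s : Multiset ℚ}
    (hs : IsFactorization M q s) : q ∈ M :=
  hs.2 ▸ M.multiset_sum_mem s fun a ha => (hs.1 a ha).1

theorem LFFM.finite {M : AddSubmonoid ℚ} (h : LFFM M) (q : ℚ) (l : ℕ) :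
    {s : Multiset ℚ | IsFactorization M q s ∧ Multiset.card s = l}.Finite := by
  by_cases hq : q ∈ M
  · exact h.2 q hq l
  · exact Set.finite_empty.subset fun s hs => hq hs.1.mem

/-- A new generator outside `M` is an atom of the monoid obtained by adjoining it. -/
theorem isAtom_adjoined {M : AddSubmonoid ℚ} {b : ℚ} (hM : ∀ x ∈ M, (0 : ℚ) ≤ x)
    (hb : 0 < b) (hbM : b ∉ M) : IsAtom (M ⊔ AddSubmonoid.closure {b}) b := by
  refine ⟨mem_sup_closure_singleton_s7.2 ⟨0, M.zero_mem, 1, by simp⟩, hb.ne', ?_⟩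
  intro c hc d hd h
  obtain ⟨m, hm, k, rfl⟩ := mem_sup_closure_singleton_s7.1 hc
  obtain ⟨m', hm', k', rfl⟩ := mem_sup_closure_singleton_s7.1 hd
  have h0 := hM m hm
  have h0' := hM m' hm'
  rcases Nat.eq_zero_or_pos k with rfl | hk
  · rcases Nat.eq_zero_or_pos k' with rfl | hk'
    · refine absurd ?_ hbM
      simp only [Nat.cast_zero, zero_mul, add_zero] at h
      exact h ▸ M.add_mem hm hm'
    · left
      have : (1 : ℚ) ≤ k' := by exact_mod_cast hk'
      simp only [Nat.cast_zero, zero_mul, add_zero] at h ⊢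
      nlinarith
  · right
    have hk1 : (1 : ℚ) ≤ k := by exact_mod_cast hk
    have : 0 ≤ (k' : ℚ) * b := by positivity
    nlinarith

/-- In a representation `m + n * b` with `n` maximal, every atom of `M` dividing `m` remains an
atom after adjoining `b`. -/
theorem isAtom_sup_of_maximal {M : AddSubmonoid ℚ} {a b r : ℚ} {n : ℕ} (ha : IsAtom M a)
    (hr : r ∈ M) (hmax : ∀ m ∈ M, ∀ k : ℕ, m + k * b = a + r + n * b → k ≤ n) :
    IsAtom (M ⊔ AddSubmonoid.closure {b}) a := by
  refine ⟨AddSubmonoid.mem_sup_left ha.1, ha.2.1, ?_⟩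
  intro c hc d hd h
  obtain ⟨m, hm, k, rfl⟩ := mem_sup_closure_singleton_s7.1 hc
  obtain ⟨m', hm', k', rfl⟩ := mem_sup_closure_singleton_s7.1 hd
  have hle := hmax (m + m' + r) (M.add_mem (M.add_mem hm hm') hr) (k + k' + n)
    (by push_cast; rw [h]; ring)
  obtain rfl : k = 0 := by omega
  obtain rfl : k' = 0 := by omega
  simp only [Nat.cast_zero, zero_mul, add_zero] at h ⊢
  exact ha.2.2 m hm m' hm' h

theorem Atomic.sup_closure_singleton {M : AddSubmonoid ℚ} {b : ℚ} (h : Atomic M)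
    (hM : ∀ x ∈ M, (0 : ℚ) ≤ x) (hb : 0 < b) (hbM : b ∉ M) :
    Atomic (M ⊔ AddSubmonoid.closure {b}) := by
  classical
  intro x hx
  let P : ℕ → Prop := fun n => ∃ m ∈ M, m + n * b = x
  obtain ⟨m₀, hm₀, n₀, hx₀⟩ := mem_sup_closure_singleton_s7.1 hx
  have hbound : ∀ n, P n → n ≤ ⌊x / b⌋₊ := by
    rintro n ⟨m, hm, rfl⟩
    have := hM m hm
    exact Nat.le_floor ((le_div_iff₀ hb).2 (by linarith))
  have hP : P n₀ := ⟨m₀, hm₀, hx₀⟩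
  obtain ⟨m, hm, hmx⟩ := Nat.findGreatest_spec (hbound _ hP) hP
  set n := Nat.findGreatest P ⌊x / b⌋₊
  have hmax : ∀ m' ∈ M, ∀ k : ℕ, m' + k * b = m + n * b → k ≤ n := by
    intro m' hm' k hk
    have hPk : P k := ⟨m', hm', hk.trans hmx⟩
    exact Nat.le_findGreatest (hbound k hPk) hPk
  have hb_atom : b ∈ {a : ℚ | IsAtom (M ⊔ AddSubmonoid.closure {b}) a} :=
    isAtom_adjoined hM hb hbM
  rw [← hmx, ← nsmul_eq_mul]
  refine AddSubmonoid.add_mem _ ?_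
    (AddSubmonoid.nsmul_mem _ (AddSubmonoid.subset_closure hb_atom) n)
  obtain ⟨s, hs, rfl⟩ := AddSubmonoid.exists_multiset_of_mem_closure (h m hm)
  refine AddSubmonoid.multiset_sum_mem _ _ fun a ha => AddSubmonoid.subset_closure ?_
  refine isAtom_sup_of_maximal (hs a ha) (n := n) (r := (s.erase a).sum)
    (M.multiset_sum_mem _ fun c hc => (hs c (Multiset.mem_of_mem_erase hc)).1) ?_
  rw [Multiset.sum_erase ha]
  exact hmax

theorem isAtom_or_eq_of_isAtom_sup {M : AddSubmonoid ℚ} {a b : ℚ}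
    (ha : IsAtom (M ⊔ AddSubmonoid.closure {b}) a) : IsAtom M a ∨ a = b := by
  obtain ⟨m, hm, n, rfl⟩ := mem_sup_closure_singleton_s7.1 ha.1
  cases n with
  | zero => exact .inl (ha.of_le le_sup_left (by simpa using hm))
  | succ n =>
    have hmem : m + n * b ∈ M ⊔ AddSubmonoid.closure {b} :=
      mem_sup_closure_singleton_s7.2 ⟨m, hm, n, rfl⟩
    have hbmem : b ∈ M ⊔ AddSubmonoid.closure {b} :=
      mem_sup_closure_singleton_s7.2 ⟨0, M.zero_mem, 1, by simp⟩
    have heq : m + ((n + 1 : ℕ) : ℚ) * b = m + n * b + b := by push_cast; ring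
    rcases ha.2.2 _ hmem _ hbmem heq with h0 | h0
    · exact .inr (by rw [heq, h0, zero_add])
    · subst h0
      exact .inl (ha.of_le le_sup_left (by simpa using hm))

theorem LFFM.sup_closure_singleton {M : AddSubmonoid ℚ} {b : ℚ} (h : LFFM M)
    (hM : ∀ x ∈ M, (0 : ℚ) ≤ x) (hb : 0 ≤ b) :
    LFFM (M ⊔ AddSubmonoid.closure {b}) := by
  by_cases hbM : b ∈ M
  · rwa [sup_eq_left.2 (by simpa using hbM)]
  have hb' : 0 < b := lt_of_le_of_ne hb fun h0 => hbM (h0 ▸ M.zero_mem)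
  refine ⟨h.1.sup_closure_singleton hM hb' hbM, fun q _ l => ?_⟩
  refine (Set.Finite.biUnion (Set.finite_Iic l) fun j _ =>
    (h.finite (q - j * b) (l - j)).image fun t => Multiset.replicate j b + t).subset ?_
  rintro s ⟨⟨hs, hsum⟩, hcard⟩
  have hsplit : Multiset.replicate (s.count b) b + s.filter (¬ · = b) = s := by
    rw [← Multiset.filter_eq']
    exact Multiset.filter_add_not _ s
  have hsum' := congrArg Multiset.sum hsplit
  have hcard' := congrArg Multiset.card hsplit
  simp only [Multiset.sum_add, Multiset.sum_replicate, nsmul_eq_mul, hsum] at hsum'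
  simp only [Multiset.card_add, Multiset.card_replicate, hcard] at hcard'
  refine Set.mem_biUnion (Set.mem_Iic.2 (hcard ▸ Multiset.count_le_card b s))
    ⟨s.filter (¬ · = b), ⟨⟨fun a ha => ?_, by linarith⟩, by omega⟩, hsplit⟩
  obtain ⟨has, hab⟩ := Multiset.mem_filter.1 ha
  exact (isAtom_or_eq_of_isAtom_sup (hs a has)).resolve_right hab

/-- If `M` and `N` are Puiseux monoids such that `N` is finitely generated and
`M` is a LFFM, then the internal sum `M + N` is a LFFM. -/
theorem lffm_sup_of_lffm_of_fg (M N : AddSubmonoid ℚ)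
    (hM : ∀ x ∈ M, (0 : ℚ) ≤ x) (hN : ∀ x ∈ N, (0 : ℚ) ≤ x)
    (hfg : N.FG) (h : LFFM M) :
    LFFM (M ⊔ N) := by
  classical
  obtain ⟨S, rfl⟩ := hfg
  induction S using Finset.induction_on with
  | empty => simpa using h
  | insert b S _ ih =>
    have hb : 0 ≤ b := hN b (AddSubmonoid.subset_closure (by simp))
    have hS : ∀ x ∈ AddSubmonoid.closure (S : Set ℚ), (0 : ℚ) ≤ x := fun x hx =>
      hN x (AddSubmonoid.closure_mono (by simp) hx)
    rw [Finset.coe_insert, Set.insert_eq, AddSubmonoid.closure_union,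
      sup_comm (AddSubmonoid.closure {b}), ← sup_assoc]
    exact (ih hS).sup_closure_singleton (nonneg_of_mem_sup hM hS) hb

end PuiseuxSum
end

section
/- For each n ∈ ℕ, let p_n denote the n-th prime number that is at least 5, and let M_B be the Puiseux monoid generated by B := {(p_n + 1)/p_n : n ∈ ℕ}. Then the set of atoms of M_B is exactly B, and M_B is a finite factorization monoid (FFM). -/
namespace PuiseuxSum

/-- The set `B = {(p + 1)/p : p prime, p ≥ 5}`
(equivalently `{(pₙ + 1)/pₙ : n ∈ ℕ}` where `pₙ` is the `n`-th prime
that is at least `5`). -/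
def setB : Set ℚ :=
  {q : ℚ | ∃ p : ℕ, Nat.Prime p ∧ 5 ≤ p ∧ q = ((p : ℚ) + 1) / p}

/-- Every nonzero element of the monoid generated by `setB` is at least `1`. -/
lemma eq_zero_or_one_le_of_mem_closure_setB {x : ℚ} (hx : x ∈ AddSubmonoid.closure setB) :
    x = 0 ∨ 1 ≤ x := by
  induction hx using AddSubmonoid.closure_induction with
  | mem x hx =>
    obtain ⟨p, hp, -, rfl⟩ := hx
    have hp0 : (0 : ℚ) < p := by exact_mod_cast hp.pos
    right
    rw [le_div_iff₀ hp0]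
    linarith
  | zero => exact Or.inl rfl
  | add x y _ _ hx hy =>
    rcases hx with rfl | hx
    · simpa using hy
    · rcases hy with rfl | hy
      · right; simpa using hx
      · right; linarith

/-- An atom of the monoid generated by `S` belongs to `S`. -/
lemma IsAtom.mem_of_closure {S : Set ℚ} {a : ℚ} (ha : IsAtom (AddSubmonoid.closure S) a) :
    a ∈ S := by
  suffices h : ∀ x ∈ AddSubmonoid.closure S, IsAtom (AddSubmonoid.closure S) x → x ∈ S from
    h a ha.1 ha
  intro x hx
  induction hx using AddSubmonoid.closure_induction with
  | mem x hx => exact fun _ => hx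
  | zero => exact fun h => absurd rfl h.2.1
  | add x y hx hy ihx ihy =>
    intro h
    rcases h.2.2 x hx y hy rfl with rfl | rfl
    · rw [zero_add] at h ⊢
      exact ihy h
    · rw [add_zero] at h ⊢
      exact ihx h

lemma isAtom_closure_setB_iff {a : ℚ} : IsAtom (AddSubmonoid.closure setB) a ↔ a ∈ setB := by
  refine ⟨IsAtom.mem_of_closure, fun ha => ?_⟩
  have hmem := AddSubmonoid.subset_closure ha
  obtain ⟨p, hp, h5, rfl⟩ := ha
  have hp5 : (5 : ℚ) ≤ p := by exact_mod_cast h5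
  have hp0 : (0 : ℚ) < p := by linarith
  refine ⟨hmem, by positivity, fun b hb c hc h => ?_⟩
  have hlt : ((p : ℚ) + 1) / p < 2 := by
    rw [div_lt_iff₀ hp0]
    linarith
  by_contra! hbc
  have hb1 := (eq_zero_or_one_le_of_mem_closure_setB hb).resolve_left hbc.1
  have hc1 := (eq_zero_or_one_le_of_mem_closure_setB hc).resolve_left hbc.2
  linarith

/-- Rationals whose denominator is prime to `p` are closed under addition. -/
lemma not_dvd_den_add {p : ℕ} (hp : p.Prime) {x y : ℚ} (hx : ¬ p ∣ x.den) (hy : ¬ p ∣ y.den) :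
    ¬ p ∣ (x + y).den := fun h =>
  (hp.dvd_mul.1 (h.trans (Rat.add_den_dvd x y))).elim hx hy

lemma not_dvd_den_multiset_sum {p : ℕ} (hp : p.Prime) (s : Multiset ℚ)
    (hs : ∀ x ∈ s, ¬ p ∣ x.den) : ¬ p ∣ s.sum.den := by
  induction s using Multiset.induction with
  | empty => simpa using hp.one_lt.ne'
  | cons a s ih =>
    rw [Multiset.sum_cons]
    exact not_dvd_den_add hp (hs a (Multiset.mem_cons_self a s))
      (ih fun x hx => hs x (Multiset.mem_cons_of_mem hx))

lemma card_le_sum_of_subset_setB (s : Multiset ℚ) (hs : ∀ x ∈ s, x ∈ setB) :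
    (s.card : ℚ) ≤ s.sum := by
  have h := Multiset.card_nsmul_le_sum (s := s) (a := (1 : ℚ)) fun x hx => by
    obtain ⟨p, hp, -, rfl⟩ := hs x hx
    have hp0 : (0 : ℚ) < p := by exact_mod_cast hp.pos
    rw [le_div_iff₀ hp0]
    linarith
  simpa using h

/-- A prime not dividing the denominator of the sum of a multiset over `setB` divides the
multiplicity of the corresponding generator. -/
lemma dvd_count_of_not_dvd_den_sum {p : ℕ} (hp : p.Prime) (s : Multiset ℚ)
    (hs : ∀ x ∈ s, x ∈ setB) (hden : ¬ p ∣ s.sum.den) :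
    p ∣ s.count (((p : ℚ) + 1) / p) := by
  set a : ℚ := ((p : ℚ) + 1) / p with ha
  have hp0 : (p : ℚ) ≠ 0 := by exact_mod_cast hp.ne_zero
  set k := s.count a
  have hrest : ¬ p ∣ (s.filter fun x => ¬ x = a).sum.den := by
    refine not_dvd_den_multiset_sum hp _ fun x hx hpx => ?_
    rw [Multiset.mem_filter] at hx
    obtain ⟨r, hr, -, rfl⟩ := hs x hx.1
    have hdvd : (((r : ℚ) + 1) / r).den ∣ r := by
      have := Rat.den_dvd ((r : ℤ) + 1) r
      rw [Rat.divInt_eq_div] at this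
      push_cast at this
      exact_mod_cast this
    exact hx.2 (by rw [ha, (Nat.prime_dvd_prime_iff_eq hp hr).1 (hpx.trans hdvd)])
  have hsum : (k : ℚ) * a + (s.filter fun x => ¬ x = a).sum = s.sum := by
    conv_rhs => rw [← Multiset.filter_add_not (fun x => x = a) s, Multiset.sum_add,
      Multiset.filter_eq', Multiset.sum_replicate, nsmul_eq_mul]
  have hneg : ¬ p ∣ (-(s.filter fun x => ¬ x = a).sum).den := by rwa [Rat.neg_den]
  have hy := not_dvd_den_add hp hden hneg
  set y := s.sum + -(s.filter fun x => ¬ x = a).sum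
  have hyk : y * p = k * (p + 1) := by
    have : y = k * a := by simp only [y]; linarith
    rw [this, ha]
    field_simp
  have hint : y.num * p = k * (p + 1) * y.den := by
    have hd : (y.den : ℚ) ≠ 0 := by exact_mod_cast y.den_ne_zero
    have : (y.num : ℚ) * p = k * (p + 1) * y.den := by
      rw [← hyk, ← Rat.mul_den_eq_num]
      ring
    exact_mod_cast this
  have h1 : (p : ℤ) ∣ ((k * (p + 1) * y.den : ℕ) : ℤ) := by
    push_cast
    exact hint ▸ dvd_mul_left _ _
  rcases hp.dvd_mul.1 (Int.natCast_dvd_natCast.1 h1) with h | h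
  · refine (hp.dvd_mul.1 h).resolve_right fun h' => hp.one_lt.ne' ?_
    exact Nat.dvd_one.1 ((Nat.dvd_add_right dvd_rfl).1 h')
  · exact absurd h hy

/-- Only finitely many multisets over `setB` have a given sum. -/
lemma finite_multisets_over_setB_with_sum (q : ℚ) :
    {s : Multiset ℚ | (∀ a ∈ s, a ∈ setB) ∧ s.sum = q}.Finite := by
  classical
  set n := ⌊q⌋₊
  set T := (Finset.range (max q.den n + 1)).image fun p : ℕ => ((p : ℚ) + 1) / p
  refine ((n • T.val).powerset.toFinset.finite_toSet).subset ?_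
  rintro s ⟨hs, rfl⟩
  have hcard : s.card ≤ n := Nat.le_floor (card_le_sum_of_subset_setB s hs)
  simp only [Finset.mem_coe, Multiset.mem_toFinset, Multiset.mem_powerset]
  refine Multiset.le_iff_count.2 fun a => ?_
  by_cases has : a ∈ s
  · have hcount : s.count a ≤ n := (Multiset.count_le_card a s).trans hcard
    have haT : a ∈ T := by
      obtain ⟨p, hp, -, rfl⟩ := hs a has
      refine Finset.mem_image.2 ⟨p, Finset.mem_range.2 (Nat.lt_succ_of_le ?_), rfl⟩
      by_cases hpd : p ∣ s.sum.den
      · exact (Nat.le_of_dvd s.sum.den_pos hpd).trans (le_max_left _ _)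
      · have hpk := Nat.le_of_dvd (Multiset.count_pos.2 has)
          (dvd_count_of_not_dvd_den_sum hp s hs hpd)
        exact (hpk.trans hcount).trans (le_max_right _ _)
    rw [Multiset.count_nsmul, Multiset.count_eq_one_of_mem T.nodup haT, mul_one]
    exact hcount
  · simp [Multiset.count_eq_zero_of_notMem has]

/-- The set of atoms of `M_B := ⟨setB⟩` is exactly `setB`, and `M_B` is a
finite factorization monoid. -/
theorem atoms_MB_and_ffm :
    {a : ℚ | IsAtom (AddSubmonoid.closure setB) a} = setB ∧
      FFM (AddSubmonoid.closure setB) := by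
  have hatoms : {a : ℚ | IsAtom (AddSubmonoid.closure setB) a} = setB :=
    Set.ext fun _ => isAtom_closure_setB_iff
  refine ⟨hatoms, fun x hx => hatoms.symm ▸ hx, fun q _ => ?_⟩
  simpa only [IsFactorization, isAtom_closure_setB_iff] using
    finite_multisets_over_setB_with_sum q

end PuiseuxSum
end

section
/- For each n ∈ ℕ, let p_n denote the n-th prime number. Let M₁ := {0} ∪ {q ∈ ℚ : q ≥ 1} and let M₂ be the Puiseux monoid generated by {(p_n + 1)/p_n² : n ∈ ℕ}, and set M := M₁ + M₂. Then every atom of M lies in {1} ∪ {(p_n + 1)/p_n² : n ∈ ℕ}, the element 9/8 ∈ M is not a finite sum of atoms of M, and hence M is not atomic (even though M₁ and M₂ are both BFMs). -/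
namespace PuiseuxSum

/-- The Puiseux monoid `M₁ := {0} ∪ {q ∈ ℚ : q ≥ 1}`. -/
def M₁ : AddSubmonoid ℚ where
  carrier := {q : ℚ | q = 0 ∨ 1 ≤ q}
  zero_mem' := Or.inl rfl
  add_mem' := by
    rintro a b (rfl | ha) (rfl | hb)
    · exact Or.inl (by simp)
    · exact Or.inr (by simpa using hb)
    · exact Or.inr (by simpa using ha)
    · exact Or.inr (by linarith)

/-- The set `C = {(p + 1)/p² : p prime}`
(equivalently `{(pₙ + 1)/pₙ² : n ∈ ℕ}` where `pₙ` is the `n`-th prime). -/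
def setC : Set ℚ :=
  {q : ℚ | ∃ p : ℕ, Nat.Prime p ∧ q = ((p : ℚ) + 1) / (p : ℚ) ^ 2}

/-- The Puiseux monoid `M₂ := ⟨setC⟩`. -/
def M₂ : AddSubmonoid ℚ := AddSubmonoid.closure setC

/-- The generator `(n + 1)/n²`. -/
def gen (n : ℕ) : ℚ := ((n : ℚ) + 1) / (n : ℚ) ^ 2

theorem gen_mem_setC {p : ℕ} (hp : p.Prime) : gen p ∈ setC := ⟨p, hp, rfl⟩

theorem inv_lt_gen {n : ℕ} (hn : 0 < n) : (1 : ℚ) / n < gen n := by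
  have hn' : (0 : ℚ) < n := by exact_mod_cast hn
  unfold gen
  rw [div_lt_div_iff₀ hn' (by positivity)]
  nlinarith

theorem gen_pos {n : ℕ} (hn : 0 < n) : 0 < gen n :=
  lt_trans (by positivity) (inv_lt_gen hn)

theorem gen_le_two_div {n : ℕ} (hn : 0 < n) : gen n ≤ 2 / n := by
  have hn' : (1 : ℚ) ≤ n := by exact_mod_cast hn
  unfold gen
  rw [div_le_div_iff₀ (by positivity) (by positivity)]
  nlinarith

theorem gen_le_one {n : ℕ} (hn : 2 ≤ n) : gen n ≤ 1 := by
  have hn' : (2 : ℚ) ≤ n := by exact_mod_cast hn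
  refine (gen_le_two_div (by omega)).trans ?_
  rw [div_le_one (by linarith)]
  exact hn'

theorem setC_pos {a : ℚ} (ha : a ∈ setC) : 0 < a := by
  obtain ⟨p, hp, rfl⟩ := ha
  exact gen_pos hp.pos

/-- The rationals whose `p`-adic norm is at most `c`. -/
def padicBall (p : ℕ) [Fact p.Prime] (c : ℚ) (hc : 0 ≤ c) : AddSubmonoid ℚ where
  carrier := {x | padicNorm p x ≤ c}
  zero_mem' := by simpa using hc
  add_mem' := fun ha hb => padicNorm.nonarchimedean.trans (max_le ha hb)

theorem padicNorm_gen_self (p : ℕ) [hp : Fact p.Prime] : padicNorm p (gen p) = (p : ℚ) ^ 2 := by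
  have h1 : padicNorm p ((p : ℚ) + 1) = 1 := by
    have : ¬ p ∣ p + 1 := fun h =>
      hp.out.one_lt.ne' (Nat.dvd_one.mp ((Nat.dvd_add_right dvd_rfl).mp h))
    exact_mod_cast (padicNorm.nat_eq_one_iff (p := p) (p + 1)).mpr this
  rw [gen, padicNorm.div, h1, sq, padicNorm.mul, padicNorm.padicNorm_p hp.out.one_lt]
  simp

theorem padicNorm_le_one_of_not_dvd_den (p : ℕ) [Fact p.Prime] {q : ℚ} (h : ¬ p ∣ q.den) :
    padicNorm p q ≤ 1 := by
  rw [← Rat.num_div_den q, padicNorm.div, (padicNorm.nat_eq_one_iff _).mpr h, div_one]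
  exact padicNorm.of_int _

theorem padicNorm_gen_of_ne (p : ℕ) [hp : Fact p.Prime] {r : ℕ} (hr : r.Prime) (hne : r ≠ p) :
    padicNorm p (gen r) ≤ 1 := by
  have h : padicNorm p r = 1 := by
    rw [padicNorm.nat_eq_one_iff]
    exact fun h => hne ((Nat.prime_dvd_prime_iff_eq hp.out hr).mp h).symm
  have h1 : padicNorm p ((r : ℚ) + 1) ≤ 1 := by exact_mod_cast padicNorm.of_nat (p := p) (r + 1)
  rw [gen, padicNorm.div, sq, padicNorm.mul, h]
  simpa using h1

/-- A sum of generators that is integral at `p` and involves the generator at `p` has to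
involve it at least `p²` times. -/
theorem add_one_le_sum_of_gen_mem {p : ℕ} [hp : Fact p.Prime] {s : Multiset ℚ}
    (hs : ∀ a ∈ s, a ∈ setC) (hq : padicNorm p s.sum ≤ 1) (hmem : gen p ∈ s) :
    (p : ℚ) + 1 ≤ s.sum := by
  have hp0 : (0 : ℚ) < p := by exact_mod_cast hp.out.pos
  set t := s.filter (fun a => a ≠ gen p) with ht
  set k := s.count (gen p) with hk
  have hsum : s.sum = k * gen p + t.sum := by
    conv_lhs => rw [← Multiset.filter_add_not (fun a => a = gen p) s]
    rw [Multiset.sum_add, Multiset.filter_eq', Multiset.sum_replicate, nsmul_eq_mul]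
  have htn : padicNorm p t.sum ≤ 1 := by
    refine AddSubmonoid.multiset_sum_mem (padicBall p 1 zero_le_one) t fun a ha => ?_
    obtain ⟨has, hne⟩ := Multiset.mem_filter.mp ha
    obtain ⟨r, hr, rfl⟩ := hs a has
    exact padicNorm_gen_of_ne p hr fun h => hne (h ▸ rfl)
  have ht0 : 0 ≤ t.sum := Multiset.sum_nonneg fun a ha =>
    (setC_pos (hs a (Multiset.mem_filter.mp ha).1)).le
  have hkn : padicNorm p k * (p : ℚ) ^ 2 ≤ 1 := by
    rw [← padicNorm_gen_self, ← padicNorm.mul, show (k : ℚ) * gen p = s.sum - t.sum by linarith]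
    exact padicNorm.sub.trans (max_le hq htn)
  have hdvd : p ^ 2 ∣ k := by
    have : ((p ^ 2 : ℕ) : ℤ) ∣ (k : ℤ) := by
      rw [padicNorm.dvd_iff_norm_le, Int.cast_natCast, zpow_neg, zpow_natCast,
        ← one_div, le_div_iff₀ (by positivity)]
      exact hkn
    exact_mod_cast this
  have hkp : (p : ℚ) ^ 2 ≤ k := by
    exact_mod_cast Nat.le_of_dvd (Multiset.count_pos.mpr hmem) hdvd
  have hmul : (p : ℚ) ^ 2 * gen p = p + 1 := by
    rw [gen]
    field_simp
  have := mul_le_mul_of_nonneg_right hkp (gen_pos hp.out.pos).le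
  linarith

theorem mem_of_isAtom_of_mem_closure {M : AddSubmonoid ℚ} {S : Set ℚ}
    (hS : AddSubmonoid.closure S ≤ M) {a : ℚ} (ha : a ∈ AddSubmonoid.closure S)
    (hatom : IsAtom M a) : a ∈ S := by
  induction ha using AddSubmonoid.closure_induction with
  | mem x hx => exact hx
  | zero => exact absurd rfl hatom.2.1
  | add x y hx hy ihx ihy =>
    rcases hatom.2.2 x (hS hx) y (hS hy) rfl with rfl | rfl
    · simpa using ihy (by simpa using hatom)
    · simpa using ihx (by simpa using hatom)

theorem bfm_of_atoms_bounded_below {M : AddSubmonoid ℚ} (hM : Atomic M)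
    (h : ∀ q ∈ M, ∃ ε : ℚ, 0 < ε ∧ ∀ s, IsFactorization M q s → ∀ a ∈ s, ε ≤ a) : BFM M := by
  refine ⟨hM, fun q hq => ?_⟩
  obtain ⟨ε, hε, hle⟩ := h q hq
  refine (Set.finite_Iic ⌊q / ε⌋₊).subset ?_
  rintro _ ⟨s, hs, rfl⟩
  refine Nat.le_floor ?_
  rw [le_div_iff₀ hε]
  simpa [hs.2] using Multiset.card_nsmul_le_sum (hle s hs)

theorem isAtom_M₁ {q : ℚ} (h1 : 1 ≤ q) (h2 : q < 2) : IsAtom M₁ q := by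
  refine ⟨Or.inr h1, by linarith, fun b hb c hc h => ?_⟩
  rcases hb with hb | hb
  · exact Or.inl hb
  · rcases hc with hc | hc
    · exact Or.inr hc
    · linarith

theorem atomic_M₁ : Atomic M₁ := by
  rintro q (rfl | hq)
  · exact zero_mem _
  have hn : 1 ≤ ⌊q⌋₊ := Nat.le_floor (by exact_mod_cast hq)
  have h1 := Nat.floor_le (zero_le_one.trans hq)
  have h2 := Nat.lt_floor_add_one q
  have hsplit : q = (⌊q⌋₊ - 1) • (1 : ℚ) + (q - ⌊q⌋₊ + 1) := by
    rw [nsmul_one, Nat.cast_sub hn]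
    push_cast
    ring
  rw [hsplit]
  refine add_mem (nsmul_mem (AddSubmonoid.subset_closure ?_) _) (AddSubmonoid.subset_closure ?_)
  · exact isAtom_M₁ le_rfl one_lt_two
  · exact isAtom_M₁ (by linarith) (by linarith)

theorem bfm_M₁ : BFM M₁ :=
  bfm_of_atoms_bounded_below atomic_M₁ fun _ _ =>
    ⟨1, one_pos, fun _ hs a ha => (hs.1 a ha).1.resolve_left (hs.1 a ha).2.1⟩

theorem isAtom_M₂ {a : ℚ} (ha : a ∈ setC) : IsAtom M₂ a := by
  obtain ⟨p, hp, rfl⟩ := id ha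
  refine ⟨AddSubmonoid.subset_closure ha, (setC_pos ha).ne', fun b hb c hc h => ?_⟩
  change gen p = b + c at h
  obtain ⟨s, hs, rfl⟩ := AddSubmonoid.exists_multiset_of_mem_closure hb
  obtain ⟨t, ht, rfl⟩ := AddSubmonoid.exists_multiset_of_mem_closure hc
  have hst : ∀ x ∈ s + t, x ∈ setC := fun x hx =>
    (Multiset.mem_add.mp hx).elim (hs x) (ht x)
  have key : ∀ x ∈ s + t, x = gen p := by
    intro x hx
    obtain ⟨r, hr, rfl⟩ := hst x hx
    by_contra hne
    have : Fact r.Prime := ⟨hr⟩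
    have hpr : p ≠ r := fun h => hne (h ▸ rfl)
    have hsum : (s + t).sum = gen p := by rw [Multiset.sum_add, h]
    have hle := add_one_le_sum_of_gen_mem hst (hsum ▸ padicNorm_gen_of_ne r hp hpr) hx
    have h1 := gen_le_one hp.two_le
    have h2 : (0 : ℚ) < r := by exact_mod_cast hr.pos
    linarith
  by_contra! hne
  have le_sum : ∀ u : Multiset ℚ, u ≤ s + t → u.sum ≠ 0 → gen p ≤ u.sum := by
    intro u hu hu0
    obtain ⟨x, hx⟩ := Multiset.exists_mem_of_ne_zero
      (show u ≠ 0 from fun h => hu0 (by rw [h, Multiset.sum_zero]))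
    rw [← key x (Multiset.mem_of_le hu hx)]
    exact Multiset.single_le_sum
      (fun y hy => (setC_pos (hst y (Multiset.mem_of_le hu hy))).le) x hx
  have h1 := le_sum s (Multiset.le_add_right s t) hne.1
  have h2 := le_sum t (Multiset.le_add_left t s) hne.2
  have h3 := gen_pos hp.pos
  linarith

theorem bfm_M₂ : BFM M₂ := by
  refine bfm_of_atoms_bounded_below
    (fun x hx => AddSubmonoid.closure_mono (fun _ => isAtom_M₂) hx) fun q _ => ?_
  have hN : 0 < max q.den ⌈q⌉₊ := lt_max_of_lt_left q.den_pos
  refine ⟨1 / (max q.den ⌈q⌉₊ : ℕ), by positivity, fun s hs a ha => ?_⟩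
  have hsC : ∀ x ∈ s, x ∈ setC := fun x hx =>
    mem_of_isAtom_of_mem_closure (M := M₂) le_rfl (hs.1 x hx).1 (hs.1 x hx)
  obtain ⟨p, hp, rfl⟩ := hsC a ha
  have : Fact p.Prime := ⟨hp⟩
  have hpN : p ≤ max q.den ⌈q⌉₊ := by
    by_contra! hlt
    obtain ⟨hden, hceil⟩ := max_lt_iff.mp hlt
    have hint : padicNorm p q ≤ 1 :=
      padicNorm_le_one_of_not_dvd_den p (Nat.not_dvd_of_pos_of_lt q.den_pos hden)
    have hle := add_one_le_sum_of_gen_mem hsC (hs.2 ▸ hint) ha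
    rw [hs.2] at hle
    have hqp : q < p := Nat.lt_of_ceil_lt hceil
    linarith
  refine le_trans ?_ (inv_lt_gen hp.pos).le
  have : (0 : ℚ) < p := by exact_mod_cast hp.pos
  exact one_div_le_one_div_of_le this (by exact_mod_cast hpN)

theorem exists_gen_le {ε : ℚ} (hε : 0 < ε) : ∃ p : ℕ, p.Prime ∧ gen p ≤ ε := by
  obtain ⟨p, hle, hp⟩ := Nat.exists_infinite_primes ⌈2 / ε⌉₊
  refine ⟨p, hp, (gen_le_two_div hp.pos).trans ?_⟩
  have hp0 : (0 : ℚ) < p := by exact_mod_cast hp.pos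
  exact (div_le_comm₀ hε hp0).mp (Nat.ceil_le.mp hle)

theorem isAtom_sup_subset : {a : ℚ | IsAtom (M₁ ⊔ M₂) a} ⊆ {(1 : ℚ)} ∪ setC := by
  intro a ha
  obtain ⟨x, hx, y, hy, rfl⟩ := AddSubmonoid.mem_sup.mp ha.1
  rcases ha.2.2 x (AddSubmonoid.mem_sup_left hx) y (AddSubmonoid.mem_sup_right hy) rfl
    with rfl | rfl
  · rw [zero_add] at ha ⊢
    exact Or.inr (mem_of_isAtom_of_mem_closure le_sup_right hy ha)
  · rw [add_zero] at ha ⊢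
    have h1 : 1 ≤ x := hx.resolve_left ha.2.1
    refine Or.inl (le_antisymm (not_lt.mp fun hlt => ?_) h1)
    obtain ⟨p, hp, hle⟩ := exists_gen_le (sub_pos.mpr hlt)
    have hrest : 1 ≤ x - gen p := by linarith
    rcases ha.2.2 (x - gen p) (AddSubmonoid.mem_sup_left (Or.inr hrest)) (gen p)
      (AddSubmonoid.mem_sup_right (AddSubmonoid.subset_closure (gen_mem_setC hp)))
      (sub_add_cancel _ _).symm with h | h
    · linarith
    · exact (gen_pos hp.pos).ne' h

theorem nine_eighths_notMem_closure_atoms :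
    (9 / 8 : ℚ) ∉ AddSubmonoid.closure {a : ℚ | IsAtom (M₁ ⊔ M₂) a} := by
  intro hmem
  have hsub : {a : ℚ | IsAtom (M₁ ⊔ M₂) a} ⊆ padicBall 2 4 (by norm_num) := by
    intro a ha
    rcases isAtom_sup_subset ha with rfl | ⟨p, hp, rfl⟩
    · change padicNorm 2 1 ≤ 4
      rw [padicNorm.one]
      norm_num
    · change padicNorm 2 (gen p) ≤ 4
      by_cases h : p = 2
      · rw [h, padicNorm_gen_self]
        norm_num
      · exact (padicNorm_gen_of_ne 2 hp h).trans (by norm_num)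
  have hle : padicNorm 2 (9 / 8) ≤ 4 := AddSubmonoid.closure_le.mpr hsub hmem
  have h9 : padicNorm 2 9 = 1 := by
    exact_mod_cast (padicNorm.nat_eq_one_iff (p := 2) 9).mpr (by norm_num)
  have h2 : padicNorm 2 2 = 1 / 2 := by
    simpa using padicNorm.padicNorm_p (p := 2) (by norm_num)
  rw [show (9 / 8 : ℚ) = 9 / (2 * 2 * 2) by norm_num, padicNorm.div, padicNorm.mul,
    padicNorm.mul, h9, h2] at hle
  norm_num at hle

/-- For `M := M₁ + M₂`: every atom of `M` lies in `{1} ∪ setC`, the element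
`9/8 ∈ M` is not a finite sum of atoms of `M`, and hence `M` is not atomic,
even though `M₁` and `M₂` are both BFMs. -/
theorem sum_of_bfms_not_atomic :
    BFM M₁ ∧ BFM M₂ ∧
      {a : ℚ | IsAtom (M₁ ⊔ M₂) a} ⊆ {(1 : ℚ)} ∪ setC ∧
      (9 / 8 : ℚ) ∈ M₁ ⊔ M₂ ∧
      (¬ ∃ s : Multiset ℚ, (∀ a ∈ s, IsAtom (M₁ ⊔ M₂) a) ∧ s.sum = (9 / 8 : ℚ)) ∧
      ¬ Atomic (M₁ ⊔ M₂) := by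
  have hmem : (9 / 8 : ℚ) ∈ M₁ ⊔ M₂ := AddSubmonoid.mem_sup_left (Or.inr (by norm_num))
  refine ⟨bfm_M₁, bfm_M₂, isAtom_sup_subset, hmem, ?_, fun h =>
    nine_eighths_notMem_closure_atoms (h _ hmem)⟩
  rintro ⟨s, hs, hsum⟩
  refine nine_eighths_notMem_closure_atoms (hsum ▸ ?_)
  exact AddSubmonoid.multiset_sum_mem _ s fun a ha => AddSubmonoid.subset_closure (hs a ha)

end PuiseuxSum
end
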